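/- Let k be an algebraically closed field and let C = ⊕ C^q be a cochain complex of finite-dimensional k-vector spaces, vanishing outside finitely many degrees, equipped with a polynomial deformation of differentials δ_t = δ_0 + t δ_1 + t^2 δ_2 + ⋯ + t^s δ_s, where each δ_j : C^* → C^{*+1} is a degree-one k-linear map and Σ_{i+j=m} δ_i δ_j = 0 for every m ≥ 0 (so δ_a^2 = 0 for every a ∈ k). Let C[t] = k[t] ⊗_k C with the k[t]-linear differential δ = Σ_j t^j δ_j, and let R denote the localization of k[t] at the prime ideal (t) (the ring of rational functions p(t)/q(t) with q(0) ≠ 0). Then the following are equivalent: (i) for every integer i, the R-module H^i(C[t], δ) ⊗_{k[t]} R is free; (ii) for every integer i, dim_k H^i(C, δ_0) equals the minimum of dim_k H^i(C, δ_a) over all a ∈ k. -/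

import Mathlib

open Polynomial

/-- Transport along an equality of degrees in a graded family of modules. -/
def gradedCast (R : Type) [CommRing R] (W : ℤ → Type)
    [∀ i, AddCommGroup (W i)] [∀ i, Module R (W i)]
    {a b : ℤ} (h : a = b) : W a →ₗ[R] W b := by
  subst h; exact LinearMap.id

/-- The degree `q` cohomology of a graded family of modules equipped with degree-one maps
`D i : W i → W (i+1)`: the quotient of `ker (D q)` by the part of `im (D (q-1))` lying
in it. -/
noncomputable def gcohomology (R : Type) [CommRing R] (W : ℤ → Type)
    [∀ i, AddCommGroup (W i)] [∀ i, Module R (W i)]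
    (D : ∀ i : ℤ, W i →ₗ[R] W (i + 1)) (q : ℤ) :=
  LinearMap.ker (D q) ⧸
    ((LinearMap.range ((gradedCast R W (by ring : q - 1 + 1 = q)).comp (D (q - 1)))).comap
      (LinearMap.ker (D q)).subtype)

noncomputable instance (R : Type) [CommRing R] (W : ℤ → Type)
    [∀ i, AddCommGroup (W i)] [∀ i, Module R (W i)]
    (D : ∀ i : ℤ, W i →ₗ[R] W (i + 1)) (q : ℤ) :
    AddCommGroup (gcohomology R W D q) :=
  inferInstanceAs (AddCommGroup (LinearMap.ker (D q) ⧸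
    ((LinearMap.range ((gradedCast R W (by ring : q - 1 + 1 = q)).comp (D (q - 1)))).comap
      (LinearMap.ker (D q)).subtype)))

noncomputable instance (R : Type) [CommRing R] (W : ℤ → Type)
    [∀ i, AddCommGroup (W i)] [∀ i, Module R (W i)]
    (D : ∀ i : ℤ, W i →ₗ[R] W (i + 1)) (q : ℤ) :
    Module R (gcohomology R W D q) :=
  inferInstanceAs (Module R (LinearMap.ker (D q) ⧸
    ((LinearMap.range ((gradedCast R W (by ring : q - 1 + 1 = q)).comp (D (q - 1)))).comap
      (LinearMap.ker (D q)).subtype)))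

/-- The specialization `δ_a = δ_0 + a δ_1 + ⋯ + a^s δ_s` of a polynomial deformation of
differentials at the point `a`. -/
noncomputable def deformAt {k : Type} [Field k] (V : ℤ → Type)
    [∀ i, AddCommGroup (V i)] [∀ i, Module k (V i)]
    (s : ℕ) (δ : ℕ → ∀ i : ℤ, V i →ₗ[k] V (i + 1)) (a : k) :
    ∀ i : ℤ, V i →ₗ[k] V (i + 1) :=
  fun i => ∑ j ∈ Finset.range (s + 1), a ^ j • δ j i

instance spanX_isPrime {k : Type} [Field k] :
    (Ideal.span {(Polynomial.X : Polynomial k)}).IsPrime :=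
  (Ideal.span_singleton_prime Polynomial.X_ne_zero).mpr Polynomial.prime_X

/-- The `k[t]`-linear differential `δ = Σ_j t^j δ_j` on the complex `C[t] = k[t] ⊗_k C` of
free finitely generated `k[t]`-modules. -/
noncomputable def bigDifferential {k : Type} [Field k] (V : ℤ → Type)
    [∀ i, AddCommGroup (V i)] [∀ i, Module k (V i)]
    (s : ℕ) (δ : ℕ → ∀ i : ℤ, V i →ₗ[k] V (i + 1)) (i : ℤ) :
    (TensorProduct k (Polynomial k) (V i)) →ₗ[Polynomial k]
      (TensorProduct k (Polynomial k) (V (i + 1))) :=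
  ∑ j ∈ Finset.range (s + 1),
    TensorProduct.AlgebraTensorModule.map
      ((LinearMap.lsmul (Polynomial k) (Polynomial k)) (Polynomial.X ^ j)) (δ j i)


namespace DefAux

theorem gradedCast_bij (R : Type) [CommRing R] (W : ℤ → Type)
    [∀ i, AddCommGroup (W i)] [∀ i, Module R (W i)]
    {a b : ℤ} (h : a = b) : Function.Bijective (gradedCast R W h) := by
  subst h; exact Function.bijective_id

theorem gradedCast_comm (R : Type) [CommRing R] (W : ℤ → Type)
    [∀ i, AddCommGroup (W i)] [∀ i, Module R (W i)]
    (D : ∀ i : ℤ, W i →ₗ[R] W (i + 1)) {a b : ℤ} (h : a = b) (x : W a)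
    (hx : D a x = 0) : D b (gradedCast R W h x) = 0 := by
  subst h; exact hx

theorem conv {k : Type} [Field k] (V : ℤ → Type)
    [∀ i, AddCommGroup (V i)] [∀ i, Module k (V i)]
    (s : ℕ) (δ : ℕ → ∀ i : ℤ, V i →ₗ[k] V (i + 1))
    (hdeg : ∀ j : ℕ, s < j → δ j = 0)
    (hrel : ∀ (m : ℕ) (i : ℤ),
      ∑ p ∈ Finset.range (m + 1), (δ p (i + 1)).comp (δ (m - p) i) = 0)
    (i : ℤ) {A : Type} [AddCommGroup A] (Φ : ℕ → (V i →ₗ[k] V (i + 1 + 1)) →+ A) :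
    ∑ p ∈ Finset.range (s + 1), ∑ q ∈ Finset.range (s + 1),
      Φ (p + q) ((δ p (i + 1)).comp (δ q i)) = 0 := by
  rw [← Finset.sum_product']
  rw [← Finset.sum_fiberwise_of_maps_to (t := Finset.range (2 * s + 1)) (g := fun x => x.1 + x.2)]
  · apply Finset.sum_eq_zero
    intro m _
    have h := congrArg (Φ m) (hrel m i)
    rw [map_zero, map_sum, ← Finset.Nat.sum_antidiagonal_eq_sum_range_succ
      (fun p q => Φ m ((δ p (i + 1)).comp (δ q i)))] at h
    rw [← h]
    trans ∑ x ∈ (Finset.range (s + 1) ×ˢ Finset.range (s + 1)).filter (fun x => x.1 + x.2 = m),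
      Φ m ((δ x.1 (i + 1)).comp (δ x.2 i))
    · apply Finset.sum_congr rfl
      intro x hx
      rw [(Finset.mem_filter.1 hx).2]
    · apply Finset.sum_subset
      · intro x hx
        simpa using (Finset.mem_filter.1 hx).2
      · intro x hx hx'
        have hx1 : x.1 + x.2 = m := by simpa using hx
        have : s < x.1 ∨ s < x.2 := by
          by_contra hc
          push Not at hc
          apply hx'
          simp only [Finset.mem_filter, Finset.mem_product, Finset.mem_range]
          omega
        rcases this with h | h <;> simp [hdeg _ h]
  · intro x hx
    simp only [Finset.mem_product, Finset.mem_range] at hx ⊢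
    omega

theorem deformAt_sq {k : Type} [Field k] (V : ℤ → Type)
    [∀ i, AddCommGroup (V i)] [∀ i, Module k (V i)]
    (s : ℕ) (δ : ℕ → ∀ i : ℤ, V i →ₗ[k] V (i + 1))
    (hdeg : ∀ j : ℕ, s < j → δ j = 0)
    (hrel : ∀ (m : ℕ) (i : ℤ),
      ∑ p ∈ Finset.range (m + 1), (δ p (i + 1)).comp (δ (m - p) i) = 0)
    (a : k) (i : ℤ) (x : V i) : deformAt V s δ a (i + 1) (deformAt V s δ a i x) = 0 := by
  have := conv V s δ hdeg hrel i
    (fun m => ((a ^ m) • LinearMap.applyₗ x : (V i →ₗ[k] V (i + 1 + 1)) →ₗ[k] _).toAddMonoidHom)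
  rw [← this]
  simp [deformAt, LinearMap.sum_apply, map_sum, Finset.smul_sum, smul_smul, pow_add]
  exact Finset.sum_comm.trans (by simp only [mul_comm])

theorem big_sq {k : Type} [Field k] (V : ℤ → Type)
    [∀ i, AddCommGroup (V i)] [∀ i, Module k (V i)]
    (s : ℕ) (δ : ℕ → ∀ i : ℤ, V i →ₗ[k] V (i + 1))
    (hdeg : ∀ j : ℕ, s < j → δ j = 0)
    (hrel : ∀ (m : ℕ) (i : ℤ),
      ∑ p ∈ Finset.range (m + 1), (δ p (i + 1)).comp (δ (m - p) i) = 0)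
    (i : ℤ) (x : TensorProduct k (Polynomial k) (V i)) :
    bigDifferential V s δ (i + 1) (bigDifferential V s δ i x) = 0 := by
  induction x with
  | zero => simp
  | add x y hx hy => rw [map_add, map_add, hx, hy, add_zero]
  | tmul p v =>
    have := conv V s δ hdeg hrel i
      (fun m => ((TensorProduct.mk k (Polynomial k) (V (i + 1 + 1)) (X ^ m * p)).comp
        (LinearMap.applyₗ v : (V i →ₗ[k] V (i + 1 + 1)) →ₗ[k] _)).toAddMonoidHom)
    rw [← this]
    simp [bigDifferential, LinearMap.sum_apply, map_sum, pow_add, mul_assoc]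
    exact Finset.sum_comm

/-- evaluation -/
noncomputable def ev {k : Type} [Field k] (V : Type) [AddCommGroup V] [Module k V] (a : k) :
    TensorProduct k (Polynomial k) V →ₗ[k] V :=
  (TensorProduct.lid k V).toLinearMap.comp (LinearMap.rTensor V (Polynomial.aeval a).toLinearMap)

theorem ev_tmul {k : Type} [Field k] (V : Type) [AddCommGroup V] [Module k V] (a : k)
    (p : Polynomial k) (v : V) : ev V a (p ⊗ₜ v) = p.eval a • v := by
  simp [ev, Polynomial.aeval_def, Polynomial.eval₂_eq_eval_map]

theorem ev_smul {k : Type} [Field k] (V : Type) [AddCommGroup V] [Module k V] (a : k)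
    (p : Polynomial k) (w : TensorProduct k (Polynomial k) V) :
    ev V a (p • w) = p.eval a • ev V a w := by
  induction w with
  | zero => simp
  | add x y hx hy => rw [smul_add, map_add, map_add, hx, hy, smul_add]
  | tmul q v => simp [TensorProduct.smul_tmul', ev_tmul, mul_smul]

theorem ev_surj {k : Type} [Field k] (V : Type) [AddCommGroup V] [Module k V] (a : k) :
    Function.Surjective (ev V a) := fun v => ⟨1 ⊗ₜ v, by simp [ev_tmul]⟩

theorem ev_big {k : Type} [Field k] (V : ℤ → Type)
    [∀ i, AddCommGroup (V i)] [∀ i, Module k (V i)]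
    (s : ℕ) (δ : ℕ → ∀ i : ℤ, V i →ₗ[k] V (i + 1)) (a : k) (i : ℤ)
    (w : TensorProduct k (Polynomial k) (V i)) :
    ev _ a (bigDifferential V s δ i w) = deformAt V s δ a i (ev _ a w) := by
  induction w with
  | zero => simp
  | add x y hx hy => rw [map_add, map_add, hx, hy, map_add, map_add]
  | tmul q v =>
    simp [bigDifferential, deformAt, LinearMap.sum_apply, ev_tmul, mul_smul, Finset.smul_sum,
      smul_comm (q.eval a)]

theorem rank_lemma {k : Type} [Field k] (V V' : Type) [AddCommGroup V] [Module k V]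
    [AddCommGroup V'] [Module k V'] [FiniteDimensional k V']
    (D : TensorProduct k (Polynomial k) V →ₗ[Polynomial k] TensorProduct k (Polynomial k) V')
    (d : k → V →ₗ[k] V') (hD : ∀ a w, ev V' a (D w) = d a (ev V a w)) :
    ∃ (n : ℕ) (P : Polynomial k), P ≠ 0 ∧
      (∀ a, Module.finrank k (LinearMap.range (d a)) ≤ n) ∧
      (∀ a, Module.finrank k (LinearMap.range (d a)) = n ↔ P.eval a ≠ 0) ∧
      (P.eval 0 ≠ 0 ↔ ∀ x, (X : Polynomial k) • x ∈ LinearMap.range D → x ∈ LinearMap.range D) := by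
  classical
  let b0 := Module.finBasis k V'
  let b1 := Algebra.TensorProduct.basis (Polynomial k) b0
  obtain ⟨n, S⟩ := Submodule.smithNormalForm b1 (LinearMap.range D)
  have hne : ∀ i, S.a i ≠ 0 := by
    intro i h0
    have h1 := S.snf i
    rw [h0, zero_smul] at h1
    exact S.bN.ne_zero i (Subtype.ext h1)
  have hspan : ∀ a, LinearMap.range (d a) =
      Submodule.span k (Set.range fun i => (S.a i).eval a • ev V' a (S.bM (S.f i))) := by
    intro a
    apply le_antisymm
    · rintro _ ⟨v, rfl⟩
      obtain ⟨w, rfl⟩ := ev_surj V a v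
      rw [← hD]
      have h := S.bN.sum_repr ⟨D w, ⟨w, rfl⟩⟩
      have h2 := congrArg Subtype.val h
      simp only [AddSubmonoidClass.coe_finsetSum, Submodule.coe_smul, S.snf] at h2
      rw [← h2, map_sum]
      refine Submodule.sum_mem _ fun i _ => ?_
      rw [ev_smul, ev_smul]
      exact Submodule.smul_mem _ _ (Submodule.subset_span ⟨i, rfl⟩)
    · rw [Submodule.span_le]
      rintro _ ⟨i, rfl⟩
      obtain ⟨w, hw⟩ := (S.bN i).2
      refine ⟨ev V a w, ?_⟩
      rw [← hD, hw, S.snf, ev_smul]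
  have hli : ∀ a, LinearIndependent k (fun j => ev V' a (S.bM j)) := by
    intro a
    apply linearIndependent_of_top_le_span_of_card_eq_finrank
    · rintro v -
      obtain ⟨w, rfl⟩ := ev_surj V' a v
      rw [← S.bM.sum_repr w, map_sum]
      refine Submodule.sum_mem _ fun i _ => ?_
      rw [ev_smul]
      exact Submodule.smul_mem _ _ (Submodule.subset_span ⟨i, rfl⟩)
    · simp
  have hmem : ∀ y, y ∈ LinearMap.range D ↔ ∃ c : Fin n → Polynomial k,
      y = ∑ i, (c i * S.a i) • S.bM (S.f i) := by
    intro y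
    constructor
    · intro hy
      refine ⟨S.bN.repr ⟨y, hy⟩, ?_⟩
      have h := S.bN.sum_repr ⟨y, hy⟩
      have h2 := congrArg Subtype.val h
      simp only [AddSubmonoidClass.coe_finsetSum, Submodule.coe_smul, S.snf] at h2
      refine h2.symm.trans ?_
      simp only [mul_smul]
    · rintro ⟨c, rfl⟩
      refine Submodule.sum_mem _ fun i _ => ?_
      rw [mul_smul, ← S.snf]
      exact Submodule.smul_mem _ _ (S.bN i).2
  refine ⟨n, ∏ i, S.a i, Finset.prod_ne_zero_iff.2 fun i _ => hne i, ?_, ?_, ?_⟩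
  · intro a
    rw [hspan]
    exact (finrank_range_le_card _).trans (by simp)
  · intro a
    rw [hspan, Polynomial.eval_prod, Finset.prod_ne_zero_iff]
    have := linearIndependent_iff_card_eq_finrank_span (R := k)
      (b := fun i => (S.a i).eval a • ev V' a (S.bM (S.f i)))
    rw [Fintype.card_fin, Set.finrank] at this
    rw [eq_comm, ← this]
    constructor
    · intro h i _ h0
      exact h.ne_zero i (by simp [h0])
    · intro h
      have h3 := ((hli a).comp S.f S.f.injective).units_smul
        (fun i => Units.mk0 _ (h i (Finset.mem_univ i)))
      exact h3
  · rw [Polynomial.eval_prod, Finset.prod_ne_zero_iff]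
    constructor
    · intro h x hx
      obtain ⟨c, hc⟩ := (hmem _).1 hx
      have hd : ∀ i, (X : Polynomial k) ∣ c i := by
        intro i
        have h1 := congrArg (fun y => S.bM.repr y (S.f i)) hc
        simp only [map_smul, map_sum, Finsupp.smul_apply, Module.Basis.repr_self, Finsupp.finsetSum_apply, Finsupp.single_apply, S.f.injective.eq_iff, smul_eq_mul, mul_ite, mul_one, mul_zero, Finset.sum_ite_eq', Finset.mem_univ, if_true] at h1
        have h2 : (X : Polynomial k) ∣ c i * S.a i := ⟨_, h1.symm⟩
        rcases Polynomial.prime_X.dvd_or_dvd h2 with h3 | h3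
        · exact h3
        · exact absurd (by rwa [Polynomial.X_dvd_iff, Polynomial.coeff_zero_eq_eval_zero] at h3) (h i (Finset.mem_univ i))
      choose e he using hd
      refine (hmem x).2 ⟨e, ?_⟩
      apply S.bM.repr.injective
      ext1 j
      have h1 := congrArg (fun y => S.bM.repr y j) hc
      simp only [he, mul_assoc, mul_smul (X : Polynomial k), ← Finset.smul_sum] at h1
      rw [map_smul, map_smul, Finsupp.smul_apply, Finsupp.smul_apply, smul_eq_mul, smul_eq_mul] at h1
      exact mul_left_cancel₀ Polynomial.X_ne_zero h1
    · intro h i _ h0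
      rw [← Polynomial.coeff_zero_eq_eval_zero, ← Polynomial.X_dvd_iff] at h0
      obtain ⟨e, he⟩ := h0
      have h1 := h (e • S.bM (S.f i)) (by
        rw [smul_smul, ← he, ← S.snf]; exact (S.bN i).2)
      obtain ⟨c, hc⟩ := (hmem _).1 h1
      have h1 := congrArg (fun y => S.bM.repr y (S.f i)) hc
      simp only [map_smul, map_sum, Finsupp.smul_apply, Module.Basis.repr_self, Finsupp.finsetSum_apply, Finsupp.single_apply, S.f.injective.eq_iff, smul_eq_mul, mul_ite, mul_one, mul_zero, Finset.sum_ite_eq', Finset.mem_univ, if_true] at h1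
      have he0 : e ≠ 0 := by
        rintro rfl
        exact hne i (by simpa using he)
      rw [he] at h1
      have h2 : e * (1 - c i * X) = 0 := by linear_combination h1
      have h3 := congrArg (Polynomial.eval 0) ((mul_eq_zero.1 h2).resolve_left he0)
      simp at h3

theorem free_iff' {k : Type} [Field k] (M : Type) [AddCommGroup M] [Module (Polynomial k) M]
    [Module.Finite (Polynomial k) M]
    (R : Type) [CommRing R] [IsDomain R] [Algebra (Polynomial k) R]
    (I : Ideal (Polynomial k)) [I.IsPrime] (hI : Ideal.span {(Polynomial.X : Polynomial k)} = I)
    [IsLocalization.AtPrime R I]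
    (N : Type) [AddCommGroup N] [Module (Polynomial k) N] [Module R N]
    [IsScalarTower (Polynomial k) R N] (f : M →ₗ[Polynomial k] N)
    [IsLocalizedModule I.primeCompl f] :
    Module.Free R N ↔ ∀ m : M, (X : Polynomial k) • m = 0 → m = 0 := by
  have : IsDiscreteValuationRing R :=
    IsLocalization.AtPrime.isDiscreteValuationRing_of_dedekind_domain (Polynomial k) (P := I)
      (by rw [← hI]; simp) R
  have hcompl : ∀ u : Polynomial k, u ∈ I.primeCompl ↔ ¬ X ∣ u := fun u => by
    rw [Ideal.mem_primeCompl_iff, ← hI, Ideal.mem_span_singleton]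
  have hinj : Function.Injective (algebraMap (Polynomial k) R) :=
    IsLocalization.injective R I.primeCompl_le_nonZeroDivisors
  constructor
  · intro hfree m hm
    have h1 : (algebraMap (Polynomial k) R X) • f m = 0 := by
      rw [algebraMap_smul, ← map_smul, hm, map_zero]
    have hX : (algebraMap (Polynomial k) R X) ≠ 0 := by
      intro h0
      exact Polynomial.X_ne_zero (hinj (h0.trans (map_zero _).symm))
    have h2 : f m = 0 := (smul_eq_zero.1 h1).resolve_left hX
    obtain ⟨⟨u, hu⟩, hum⟩ := (IsLocalizedModule.eq_zero_iff I.primeCompl f).1 h2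
    change u • m = 0 at hum
    have hcop : IsCoprime (X : Polynomial k) u :=
      (Polynomial.irreducible_X.coprime_iff_not_dvd).2 ((hcompl u).1 hu)
    obtain ⟨a, b, hab⟩ := hcop
    rw [← one_smul (Polynomial k) m, ← hab, add_smul, mul_smul, mul_smul, hm, hum]
    simp
  · intro h
    have htf : Module.IsTorsionFree R N := by
      rw [Module.isTorsionFree_iff_smul_eq_zero]
      intro r z hrz
      by_contra hc
      push Not at hc
      obtain ⟨hr, hz⟩ := hc
      obtain ⟨⟨m, u⟩, hmu⟩ := IsLocalizedModule.surj I.primeCompl f z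
      obtain ⟨⟨p, v⟩, hpv⟩ := IsLocalization.surj I.primeCompl r
      change (u : Polynomial k) • z = f m at hmu
      change r * algebraMap _ R (v : Polynomial k) = algebraMap _ R p at hpv
      have hp : p ≠ 0 := by
        rintro rfl
        rw [map_zero] at hpv
        rcases mul_eq_zero.1 hpv with h1 | h1
        · exact hr h1
        · have h2 : (v : Polynomial k) = 0 := hinj (h1.trans (map_zero _).symm)
          exact (hcompl v).1 v.2 (by rw [h2]; exact dvd_zero _)
      have h1 : f (p • m) = 0 := by
        rw [map_smul, ← hmu, ← algebraMap_smul R p, ← hpv, mul_comm, mul_smul,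
          ← algebraMap_smul R (u : Polynomial k), smul_comm r, hrz, smul_zero, smul_zero]
      obtain ⟨w, hw⟩ := (IsLocalizedModule.eq_zero_iff I.primeCompl f).1 h1
      change (w : Polynomial k) • p • m = 0 at hw
      obtain ⟨e, q, hq, rfl⟩ := WfDvdMonoid.max_power_factor hp (Polynomial.irreducible_X)
      have hX : ∀ (e : ℕ) (m : M), (X ^ e : Polynomial k) • m = 0 → m = 0 := by
        intro e
        induction e with
        | zero => intro m hm; simpa using hm
        | succ e ih => intro m hm; rw [pow_succ, mul_smul] at hm; exact h _ (ih _ hm)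
      have h2 : (w * q : Polynomial k) • m = 0 := by
        apply hX e
        rw [← hw, smul_smul, smul_smul]
        congr 1
        ring
      have h3 : f m = 0 := (IsLocalizedModule.eq_zero_iff I.primeCompl f).2
        ⟨⟨(w : Polynomial k) * q, I.primeCompl.mul_mem w.2 ((hcompl q).2 hq)⟩, by
          rw [Submonoid.mk_smul]; exact h2⟩
      rw [h3] at hmu
      rw [← algebraMap_smul R (u : Polynomial k)] at hmu
      exact hz ((IsLocalization.map_units R u).smul_eq_zero.1 hmu)
    have : Module.Finite R N := Module.Finite.of_isLocalizedModule I.primeCompl f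
    exact Module.free_of_finite_type_torsion_free'

theorem free_iff {k : Type} [Field k] (M : Type) [AddCommGroup M] [Module (Polynomial k) M]
    [Module.Finite (Polynomial k) M] :
    Module.Free (Localization.AtPrime (Ideal.span {(Polynomial.X : Polynomial k)}))
        (TensorProduct (Polynomial k)
          (Localization.AtPrime (Ideal.span {(Polynomial.X : Polynomial k)})) M) ↔
    ∀ m : M, (X : Polynomial k) • m = 0 → m = 0 := by
  have : IsDomain (Localization.AtPrime (Ideal.span {(Polynomial.X : Polynomial k)})) :=
    inferInstance
  exact free_iff' M (Localization.AtPrime (Ideal.span {(Polynomial.X : Polynomial k)}))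
    (Ideal.span {(Polynomial.X : Polynomial k)}) rfl
    (TensorProduct (Polynomial k)
      (Localization.AtPrime (Ideal.span {(Polynomial.X : Polynomial k)})) M)
    (TensorProduct.mk (Polynomial k)
      (Localization.AtPrime (Ideal.span {(Polynomial.X : Polynomial k)})) M 1)

theorem finrank_coh {k : Type} [Field k] (V : ℤ → Type)
    [∀ i, AddCommGroup (V i)] [∀ i, Module k (V i)] [∀ i, FiniteDimensional k (V i)]
    (D : ∀ i : ℤ, V i →ₗ[k] V (i + 1)) (hD : ∀ i x, D (i + 1) (D i x) = 0) (q : ℤ) :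
    Module.finrank k (gcohomology k V D q) + Module.finrank k (LinearMap.range (D (q - 1)))
      + Module.finrank k (LinearMap.range (D q)) = Module.finrank k (V q) := by
  set g := gradedCast k V (by ring : q - 1 + 1 = q) with hg
  have hgb : Function.Bijective g := gradedCast_bij k V _
  have hle : LinearMap.range (g.comp (D (q - 1))) ≤ LinearMap.ker (D q) := by
    rintro _ ⟨x, rfl⟩
    exact gradedCast_comm k V D _ _ (hD _ x)
  have h1 := Submodule.finrank_quotient_add_finrank
    ((LinearMap.range (g.comp (D (q - 1)))).comap (LinearMap.ker (D q)).subtype)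
  have h2 : Module.finrank k ((LinearMap.range (g.comp (D (q - 1)))).comap
      (LinearMap.ker (D q)).subtype) = Module.finrank k (LinearMap.range (D (q - 1))) := by
    rw [(Submodule.comapSubtypeEquivOfLe hle).finrank_eq, LinearMap.range_comp]
    exact (Submodule.equivMapOfInjective g hgb.1 _).finrank_eq.symm
  have h3 := LinearMap.finrank_range_add_finrank_ker (D q)
  rw [h2] at h1
  change Module.finrank k (gcohomology k V D q) + _ = _ at h1
  omega

theorem coh_tf {k : Type} [Field k] (W : ℤ → Type)
    [∀ i, AddCommGroup (W i)] [∀ i, Module (Polynomial k) (W i)]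
    [∀ i, Module.IsTorsionFree (Polynomial k) (W i)]
    (D : ∀ i : ℤ, W i →ₗ[Polynomial k] W (i + 1)) (hD : ∀ i x, D (i + 1) (D i x) = 0) (q : ℤ) :
    (∀ m : gcohomology (Polynomial k) W D q, (X : Polynomial k) • m = 0 → m = 0) ↔
    ∀ x, (X : Polynomial k) • x ∈ LinearMap.range (D (q - 1)) → x ∈ LinearMap.range (D (q - 1)) := by
  set g := gradedCast (Polynomial k) W (by ring : q - 1 + 1 = q) with hg
  have hgb : Function.Bijective g := gradedCast_bij _ W _
  have hmem : ∀ x, g x ∈ LinearMap.range (g.comp (D (q - 1))) ↔ x ∈ LinearMap.range (D (q - 1)) := by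
    intro x
    constructor
    · rintro ⟨y, hy⟩
      exact ⟨y, hgb.1 hy⟩
    · rintro ⟨y, rfl⟩
      exact ⟨y, rfl⟩
  have hle : LinearMap.range (g.comp (D (q - 1))) ≤ LinearMap.ker (D q) := by
    rintro _ ⟨x, rfl⟩
    exact gradedCast_comm _ W D _ _ (hD _ x)
  set S := (LinearMap.range (g.comp (D (q - 1)))).comap (LinearMap.ker (D q)).subtype with hS
  have key : (∀ m : gcohomology (Polynomial k) W D q, (X : Polynomial k) • m = 0 → m = 0) ↔
      ∀ y : LinearMap.ker (D q), (X : Polynomial k) • y ∈ S → y ∈ S := by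
    constructor
    · intro h y hy
      have := h (S.mkQ y) (by
        change (X : Polynomial k) • S.mkQ y = 0
        rw [← map_smul]; exact (Submodule.Quotient.mk_eq_zero S).2 hy)
      exact (Submodule.Quotient.mk_eq_zero S).1 this
    · intro h m hm
      obtain ⟨y, rfl⟩ := S.mkQ_surjective m
      refine (Submodule.Quotient.mk_eq_zero S).2 (h y ((Submodule.Quotient.mk_eq_zero S).1 ?_))
      exact hm
  rw [key]
  constructor
  · intro h x hx
    have h1 := (hmem _).2 hx
    have h2 : g x ∈ LinearMap.ker (D q) := by
      have h3 := hle h1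
      rw [LinearMap.mem_ker, map_smul, map_smul] at h3
      exact (smul_eq_zero.1 h3).resolve_left Polynomial.X_ne_zero
    rw [map_smul] at h1
    exact (hmem _).1 (h ⟨g x, h2⟩ h1)
  · rintro h ⟨y, hy⟩ hxy
    obtain ⟨x, rfl⟩ := hgb.2 y
    change g x ∈ LinearMap.range (g.comp (D (q - 1)))
    change (X : Polynomial k) • g x ∈ LinearMap.range (g.comp (D (q - 1))) at hxy
    rw [← map_smul, hmem] at hxy
    exact (hmem _).2 (h x hxy)

theorem coh_finite {k : Type} [Field k] (W : ℤ → Type)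
    [∀ i, AddCommGroup (W i)] [∀ i, Module (Polynomial k) (W i)]
    [∀ i, Module.Finite (Polynomial k) (W i)]
    (D : ∀ i : ℤ, W i →ₗ[Polynomial k] W (i + 1)) (q : ℤ) :
    Module.Finite (Polynomial k) (gcohomology (Polynomial k) W D q) := by
  unfold gcohomology
  exact Module.Finite.quotient _ _

end DefAux

/-- Let `k` be an algebraically closed field and `(C, δ_t)` a polynomial
deformation `δ_t = δ_0 + t δ_1 + ⋯ + t^s δ_s` of a cochain complex of finite dimensional
`k`-vector spaces vanishing outside finitely many degrees.  Let `C[t] = k[t] ⊗_k C` with the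
`k[t]`-linear differential `δ = Σ_j t^j δ_j`, and let `R` be the localization of `k[t]` at the
prime ideal `(t)`.  Then the following are equivalent:
(i) for every `i`, the `R`-module `H^i(C[t], δ) ⊗_{k[t]} R` is free;
(ii) for every `i`, `dim_k H^i(C, δ_0)` equals the minimum of `dim_k H^i(C, δ_a)` over `a ∈ k`. -/
theorem deformation_free_localization_iff_dim_min
    {k : Type} [Field k] [IsAlgClosed k]
    (V : ℤ → Type) [∀ i, AddCommGroup (V i)] [∀ i, Module k (V i)]
    [∀ i, FiniteDimensional k (V i)]
    (hbounded : ∃ B : ℕ, ∀ i : ℤ, (B : ℤ) < |i| → ∀ x : V i, x = 0)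
    (s : ℕ) (δ : ℕ → ∀ i : ℤ, V i →ₗ[k] V (i + 1))
    (hdeg : ∀ j : ℕ, s < j → δ j = 0)
    (hrel : ∀ (m : ℕ) (i : ℤ),
      ∑ p ∈ Finset.range (m + 1), (δ p (i + 1)).comp (δ (m - p) i) = 0) :
    (∀ i : ℤ, Module.Free
        (Localization.AtPrime (Ideal.span {(Polynomial.X : Polynomial k)}))
        (TensorProduct (Polynomial k)
          (Localization.AtPrime (Ideal.span {(Polynomial.X : Polynomial k)}))
          (gcohomology (Polynomial k) (fun n => TensorProduct k (Polynomial k) (V n))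
            (bigDifferential V s δ) i)))
    ↔
    (∀ i : ℤ, IsLeast
        {n : ℕ | ∃ a : k, n = Module.finrank k (gcohomology k V (deformAt V s δ a) i)}
        (Module.finrank k (gcohomology k V (deformAt V s δ 0) i))) := by
  have hfree : ∀ i : ℤ, Module.IsTorsionFree (Polynomial k) (TensorProduct k (Polynomial k) (V i)) :=
    fun i => inferInstance
  choose n P hP hle heq hsat using fun i : ℤ => DefAux.rank_lemma (V i) (V (i + 1))
    (bigDifferential V s δ i) (fun a => deformAt V s δ a i)
    (fun a w => DefAux.ev_big V s δ a i w)
  have hL : ∀ i : ℤ, Module.Free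
        (Localization.AtPrime (Ideal.span {(Polynomial.X : Polynomial k)}))
        (TensorProduct (Polynomial k)
          (Localization.AtPrime (Ideal.span {(Polynomial.X : Polynomial k)}))
          (gcohomology (Polynomial k) (fun n => TensorProduct k (Polynomial k) (V n))
            (bigDifferential V s δ) i)) ↔
      Module.finrank k (LinearMap.range (deformAt V s δ 0 (i - 1))) = n (i - 1) := by
    intro i
    have := DefAux.coh_finite (fun n => TensorProduct k (Polynomial k) (V n))
      (bigDifferential V s δ) i
    rw [DefAux.free_iff, DefAux.coh_tf _ _ (DefAux.big_sq V s δ hdeg hrel), heq, hsat]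
  have hdim := fun a i => DefAux.finrank_coh V (deformAt V s δ a)
    (DefAux.deformAt_sq V s δ hdeg hrel a) i
  constructor
  · intro h i
    refine ⟨⟨0, rfl⟩, ?_⟩
    rintro _ ⟨a, rfl⟩
    have h1 := (hL i).1 (h i)
    have h2 := (hL (i + 1)).1 (h (i + 1))
    rw [show i + 1 - 1 = i by ring] at h2
    have := hdim a i
    have := hdim 0 i
    have := hle i a
    have := hle (i - 1) a
    omega
  · intro h i
    rw [hL]
    have hne : P i * P (i - 1) ≠ 0 := mul_ne_zero (hP _) (hP _)
    have : Infinite k := IsAlgClosed.instInfinite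
    obtain ⟨a, ha⟩ : ∃ a, (P i * P (i - 1)).eval a ≠ 0 := by
      by_contra hc
      push Not at hc
      exact hne (Polynomial.funext fun a => by simpa using hc a)
    rw [Polynomial.eval_mul] at ha
    have h1 := (heq i a).2 (left_ne_zero_of_mul ha)
    have h2 := (heq (i - 1) a).2 (right_ne_zero_of_mul ha)
    have h3 := (h i).2 ⟨a, rfl⟩
    have := hdim a i
    have := hdim 0 i
    have := hle i 0
    have := hle (i - 1) 0
    omega
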